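/- arXiv:1704.01951 — 2 statements merged into one kernel-verified Lean document; each statement's English description precedes it below -/
import Mathlib

section
/- Let {k_u} be a degree sequence on a finite vertex set V with k_u ≥ 1 for all u, and suppose every k_u is even. Then the multiloop-graph L consisting of exactly k_u/2 self-loops at each vertex u (and no other edges) has degree sequence {k_u}, and no double edge swap applied to L produces a multiloop-graph: every double edge swap on two self-loops (u,u),(v,v) with u ≠ v creates the non-loop edge (u,v) with multiplicity 2. Consequently L is an isolated vertex of G_ll({k_u}), and if there exists any other multiloop-graph with degree sequence {k_u}, then G_ll({k_u}) is disconnected. -/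
/-!
Multiset-based graphs: a graph on `V` is a multiset of unordered pairs (`Sym2 V`).
-/

variable {V : Type*}

/-- Degree of `u`: number of edge-endpoints at `u` (a self-loop at `u` contributes 2). -/
def mDeg [DecidableEq V] (E : Multiset (Sym2 V)) (u : V) : ℕ :=
  (E.map fun e => if e = s(u, u) then 2 else if u ∈ e then 1 else 0).sum

/-- Loopy-multigraph: every self-loop occurs with multiplicity at most 1
(non-loop pairs may repeat). -/
def IsLoopyMultigraph [DecidableEq V] (E : Multiset (Sym2 V)) : Prop :=
  ∀ u : V, E.count s(u, u) ≤ 1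

/-- Multiloop-graph: every non-loop pair occurs with multiplicity at most 1
(self-loops may repeat). -/
def IsMultiloopGraph [DecidableEq V] (E : Multiset (Sym2 V)) : Prop :=
  ∀ u v : V, u ≠ v → E.count s(u, v) ≤ 1

/-- Double edge swap: remove edges `(u,v)`, `(x,y)` (counted with multiplicity),
add the edges `(u,x)`, `(v,y)`. -/
def DoubleEdgeSwap [DecidableEq V] (E E' : Multiset (Sym2 V)) : Prop :=
  ∃ u v x y : V, ({s(u, v), s(x, y)} : Multiset (Sym2 V)) ≤ E ∧
    E' = E - {s(u, v), s(x, y)} + {s(u, x), s(v, y)}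

/-- Adjacency in the graph of graphs on the space of graphs satisfying `P`:
both graphs lie in the space and one is obtained from the other by a single double edge swap. -/
def GogAdj [DecidableEq V] (P : Multiset (Sym2 V) → Prop) (E E' : Multiset (Sym2 V)) : Prop :=
  P E ∧ P E' ∧ (DoubleEdgeSwap E E' ∨ DoubleEdgeSwap E' E)

/-- The space of loopy-multigraphs with degree sequence `k`. -/
def LMGspace [DecidableEq V] (k : V → ℕ) (E : Multiset (Sym2 V)) : Prop :=
  IsLoopyMultigraph E ∧ ∀ u, mDeg E u = k u

/-- The space of multiloop-graphs with degree sequence `k`. -/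
def MLGspace [DecidableEq V] (k : V → ℕ) (E : Multiset (Sym2 V)) : Prop :=
  IsMultiloopGraph E ∧ ∀ u, mDeg E u = k u

/-- Number of self-loops of `E` (counted with multiplicity). -/
def loopCount [DecidableEq V] (E : Multiset (Sym2 V)) : ℕ :=
  (E.filter fun e => e.IsDiag).card

/-- An open wedge: non-loop edges `(u,v)`, `(u,x)` with `v ≠ x` such that `(v,x)` is not
an edge. -/
def HasOpenWedge [DecidableEq V] (E : Multiset (Sym2 V)) : Prop :=
  ∃ u v x : V, u ≠ v ∧ u ≠ x ∧ v ≠ x ∧ s(u, v) ∈ E ∧ s(u, x) ∈ E ∧ s(v, x) ∉ E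

/-- The multiloop-graph with `k u / 2` self-loops at each vertex `u` and no other edges. -/
def allLoops [Fintype V] [DecidableEq V] (k : V → ℕ) : Multiset (Sym2 V) :=
  ∑ u : V, Multiset.replicate (k u / 2) s(u, u)

theorem eq_of_mem_allLoops [Fintype V] [DecidableEq V] {k : V → ℕ} {u v : V}
    (h : s(u, v) ∈ allLoops k) : u = v := by
  obtain ⟨w, -, hw⟩ := Multiset.mem_sum.1 h
  have := Multiset.eq_of_mem_replicate hw
  rw [Sym2.eq_iff] at this
  grind

theorem count_allLoops_of_ne [Fintype V] [DecidableEq V] (k : V → ℕ) {u v : V} (huv : u ≠ v) :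
    (allLoops k).count s(u, v) = 0 :=
  Multiset.count_eq_zero.2 fun h => huv (eq_of_mem_allLoops h)

theorem isMultiloopGraph_allLoops [Fintype V] [DecidableEq V] (k : V → ℕ) :
    IsMultiloopGraph (allLoops k) := fun u v huv => by
  simp [count_allLoops_of_ne k huv]

theorem mDeg_sum [DecidableEq V] {ι : Type*} (s : Finset ι) (E : ι → Multiset (Sym2 V)) (u : V) :
    mDeg (∑ i ∈ s, E i) u = ∑ i ∈ s, mDeg (E i) u :=
  map_sum (Multiset.sumAddMonoidHom.comp (Multiset.mapAddMonoidHom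
    fun e : Sym2 V => if e = s(u, u) then 2 else if u ∈ e then 1 else 0)) E s

theorem mDeg_replicate_loop [DecidableEq V] (n : ℕ) (u w : V) :
    mDeg (Multiset.replicate n s(w, w)) u = if w = u then n * 2 else 0 := by
  by_cases h : w = u
  · simp [mDeg, h]
  · simp [mDeg, h, Ne.symm h]

theorem mDeg_allLoops [Fintype V] [DecidableEq V] {k : V → ℕ} (heven : ∀ u, Even (k u)) (u : V) :
    mDeg (allLoops k) u = k u := by
  simp [allLoops, mDeg_sum, mDeg_replicate_loop, Nat.div_mul_cancel (heven u).two_dvd]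

theorem DoubleEdgeSwap.symm [DecidableEq V] {E E' : Multiset (Sym2 V)}
    (h : DoubleEdgeSwap E E') : DoubleEdgeSwap E' E := by
  obtain ⟨u, v, x, y, hle, rfl⟩ := h
  exact ⟨u, x, v, y, Multiset.le_add_left _ _, by
    rw [Multiset.add_sub_cancel_right, Multiset.sub_add_cancel hle]⟩

theorem DoubleEdgeSwap.eq_allLoops [Fintype V] [DecidableEq V] {k : V → ℕ}
    {E' : Multiset (Sym2 V)} (h : DoubleEdgeSwap (allLoops k) E') (hE' : IsMultiloopGraph E') :
    E' = allLoops k := by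
  obtain ⟨u, v, x, y, hle, rfl⟩ := h
  obtain rfl : u = v := eq_of_mem_allLoops (Multiset.mem_of_le hle (by simp))
  obtain rfl : x = y := eq_of_mem_allLoops (Multiset.mem_of_le hle (by simp))
  by_cases hux : u = x
  · subst hux
    exact Multiset.sub_add_cancel hle
  · have := hE' u x hux
    simp at this

/-- The all-loops graph is isolated: nothing else is reachable from it. -/
theorem eq_allLoops_of_reflTransGen [Fintype V] [DecidableEq V] {k : V → ℕ}
    {E : Multiset (Sym2 V)}
    (h : Relation.ReflTransGen (GogAdj (MLGspace k)) (allLoops k) E) : E = allLoops k := by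
  induction h with
  | refl => rfl
  | tail _ hadj ih =>
    subst ih
    obtain ⟨-, hE, hswap⟩ := hadj
    exact (hswap.elim id DoubleEdgeSwap.symm).eq_allLoops hE.1

/-- if all degrees are even (and positive), the all-loops graph `L` is a
multiloop-graph with degree sequence `k`; swapping self-loops at distinct vertices `u ≠ v`
creates the edge `(u,v)` with multiplicity 2; no double edge swap applied to `L` produces a
multiloop-graph (other than `L` itself), so `L` is isolated in the gog; hence if any other
realization exists the gog is disconnected. -/
theorem allLoops_isolated {V : Type*} [Fintype V] [DecidableEq V]
    (k : V → ℕ) (hk : ∀ u, 1 ≤ k u) (heven : ∀ u, Even (k u)) :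
    IsMultiloopGraph (allLoops k) ∧
      (∀ u, mDeg (allLoops k) u = k u) ∧
      (∀ u v : V, u ≠ v →
        (allLoops k - {s(u, u), s(v, v)} + {s(u, v), s(u, v)}).count s(u, v) = 2) ∧
      (∀ E' : Multiset (Sym2 V), DoubleEdgeSwap (allLoops k) E' → IsMultiloopGraph E' →
        E' = allLoops k) ∧
      ((∃ E' : Multiset (Sym2 V), MLGspace k E' ∧ E' ≠ allLoops k) →
        ∃ E' : Multiset (Sym2 V), MLGspace k E' ∧
          ¬ Relation.ReflTransGen (GogAdj (MLGspace k)) (allLoops k) E') := by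
  refine ⟨isMultiloopGraph_allLoops k, mDeg_allLoops heven, fun u v huv => ?_,
    fun E' hswap hE' => hswap.eq_allLoops hE', ?_⟩
  · rw [Multiset.count_add, Multiset.count_sub, count_allLoops_of_ne k huv]
    simp
  · rintro ⟨E', hE', hne⟩
    exact ⟨E', hE', fun h => hne (eq_allLoops_of_reflTransGen h)⟩
end

section
/- Let {k_u} be a degree sequence on a finite vertex set V of size n with k_u ≥ 1 for all u, such that (1) some vertex u has k_u odd, and (2) some vertex v has k_v − (n−1) negative or odd. Then every multiloop-graph G on V with degree sequence {k_u} is connected in G_ll({k_u}) by a sequence of double edge swaps to a multiloop-graph having exactly ⌊k_u/2⌋ self-loops at every vertex u, whose non-loop edges therefore form a simple graph with degree sequence {k_u mod 2} (a perfect matching on the odd-degree vertices). -/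
/-!
Multiset-based graphs: a graph on `V` is a multiset of unordered pairs (`Sym2 V`).
-/

variable {V : Type*}

section MaxLoops

variable [DecidableEq V]

/-- Number of edges that are not self-loops, counted with multiplicity. -/
def nonLoopCount (E : Multiset (Sym2 V)) : ℕ :=
  (E.filter fun e => ¬ e.IsDiag).card

theorem mDeg_zero (w : V) : mDeg 0 w = 0 := rfl

theorem mDeg_add (E F : Multiset (Sym2 V)) (w : V) : mDeg (E + F) w = mDeg E w + mDeg F w := by
  simp [mDeg]

theorem mDeg_cons (a b w : V) (E : Multiset (Sym2 V)) :
    mDeg (s(a, b) ::ₘ E) w =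
      ((if a = w then 1 else 0) + (if b = w then 1 else 0)) + mDeg E w := by
  simp only [mDeg, Multiset.map_cons, Multiset.sum_cons, Nat.add_right_cancel_iff, Sym2.eq_iff,
    Sym2.mem_iff]
  by_cases ha : a = w <;> by_cases hb : b = w <;> simp [ha, hb, eq_comm]

theorem nonLoopCount_add (E F : Multiset (Sym2 V)) :
    nonLoopCount (E + F) = nonLoopCount E + nonLoopCount F := by
  simp [nonLoopCount]

theorem nonLoopCount_pair (a b c d : V) :
    nonLoopCount {s(a, b), s(c, d)} = (if a = b then 0 else 1) + (if c = d then 0 else 1) := by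
  by_cases h : a = b <;> by_cases h' : c = d <;>
    simp [nonLoopCount, h, h', Multiset.insert_eq_cons, Multiset.filter_singleton]

theorem pair_le_of_mem {α : Type*} {a b : α} {E : Multiset α} (ha : a ∈ E) (hb : b ∈ E)
    (hab : a ≠ b) : ({a, b} : Multiset α) ≤ E := by
  rw [Multiset.le_iff_subset (by simpa using hab)]
  intro e he
  simp only [Multiset.insert_eq_cons, Multiset.mem_cons, Multiset.mem_singleton] at he
  rcases he with rfl | rfl <;> assumption

theorem sym2_mk_ne {V : Type*} {a b c d : V} (h : ¬ (a = c ∧ b = d ∨ a = d ∧ b = c)) :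
    s(a, b) ≠ s(c, d) :=
  mt Sym2.eq_iff.1 h

/-- A double edge swap whose new non-loop edges are absent from the graph and distinct stays in
the space of multiloop-graphs. -/
theorem exists_gogAdj_swap {k : V → ℕ} {E : Multiset (Sym2 V)} (hE : MLGspace k E) {u v x y : V}
    (huv : s(u, v) ∈ E) (hxy : s(x, y) ∈ E) (hne : s(u, v) ≠ s(x, y))
    (hux : u ≠ x → s(u, x) ∉ E) (hvy : v ≠ y → s(v, y) ∉ E) (hnew : s(u, x) ≠ s(v, y)) :
    ∃ E', GogAdj (MLGspace k) E E' ∧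
      nonLoopCount E' + ((if u = v then 0 else 1) + (if x = y then 0 else 1)) =
        nonLoopCount E + ((if u = x then 0 else 1) + (if v = y then 0 else 1)) ∧
      (∀ e ∈ E, e ≠ s(u, v) → e ≠ s(x, y) → e ∈ E') ∧ s(u, x) ∈ E' ∧ s(v, y) ∈ E' ∧
      (∀ e, e ∉ E → e ≠ s(u, x) → e ≠ s(v, y) → e ∉ E') := by
  have hle := pair_le_of_mem huv hxy hne
  obtain ⟨F, rfl⟩ := Multiset.le_iff_exists_add.1 hle
  have hsub : {s(u, v), s(x, y)} + F - {s(u, v), s(x, y)} + {s(u, x), s(v, y)} =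
      F + {s(u, x), s(v, y)} := by rw [add_tsub_cancel_left]
  refine ⟨F + {s(u, x), s(v, y)}, ⟨hE, ⟨?_, ?_⟩, Or.inl ⟨u, v, x, y, hle, hsub.symm⟩⟩, ?_, ?_, ?_,
    ?_, ?_⟩
  · intro a b hab
    have h := hE.1 a b hab
    rw [Multiset.count_add] at h ⊢
    have aux : ∀ c d : V, (c ≠ d → s(c, d) ∉ {s(u, v), s(x, y)} + F) → s(a, b) = s(c, d) →
        F.count s(a, b) = 0 := by
      intro c d hcd heq
      have hcd' : c ≠ d := by
        rintro rfl
        exact hab (by have := congrArg Sym2.IsDiag heq; simpa using this)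
      rw [heq]
      exact Multiset.count_eq_zero.2 fun hm => hcd hcd' (Multiset.mem_add.2 (Or.inr hm))
    have h₁ := aux u x hux
    have h₂ := aux v y hvy
    simp only [Multiset.insert_eq_cons, Multiset.count_cons, Multiset.count_singleton]
    by_cases e₁ : s(a, b) = s(u, x) <;> by_cases e₂ : s(a, b) = s(v, y)
    · exact absurd (e₁.symm.trans e₂) hnew
    · simp only [if_pos e₁, if_neg e₂, h₁ e₁]; omega
    · simp only [if_neg e₁, if_pos e₂, h₂ e₂]; omega
    · simp only [if_neg e₁, if_neg e₂]; omega
  · intro w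
    have h := hE.2 w
    rw [mDeg_add] at h ⊢
    simp only [Multiset.insert_eq_cons, ← Multiset.cons_zero, mDeg_cons, mDeg_zero] at h ⊢
    omega
  · rw [nonLoopCount_add, nonLoopCount_add, nonLoopCount_pair, nonLoopCount_pair]
    omega
  · intro e he h₁ h₂
    refine Multiset.mem_add.2 (Or.inl ?_)
    simpa [h₁, h₂] using he
  · simp
  · simp
  · intro e he h₁ h₂
    simp only [Multiset.mem_add, not_or] at he
    simp [h₁, h₂, he.2]

/-- Closing an open wedge creates a self-loop and destroys one non-loop edge. -/
theorem exists_gogAdj_close_wedge {k : V → ℕ} {E : Multiset (Sym2 V)} (hE : MLGspace k E)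
    {u v x : V} (huv : u ≠ v) (hux : u ≠ x) (hvx : v ≠ x) (huvE : s(u, v) ∈ E)
    (huxE : s(u, x) ∈ E) (hvxE : s(v, x) ∉ E) :
    ∃ E', GogAdj (MLGspace k) E E' ∧ nonLoopCount E' + 1 = nonLoopCount E ∧
      (∀ e ∈ E, e ≠ s(u, v) → e ≠ s(u, x) → e ∈ E') ∧
      (∀ e, e ∉ E → e ≠ s(u, u) → e ≠ s(v, x) → e ∉ E') := by
  obtain ⟨E', h, hc, h₁, -, -, h₂⟩ := exists_gogAdj_swap hE huvE huxE (sym2_mk_ne (by grind))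
    (fun h => absurd rfl h) (fun _ => hvxE) (sym2_mk_ne (by grind))
  exact ⟨E', h, by simpa [huv, hux, hvx] using hc, h₁, h₂⟩

/-- Without open wedges, non-loop edges can be destroyed if a triangle and an edge lie in different
components. -/
theorem exists_nonLoopCount_lt_of_disjoint {k : V → ℕ} {E : Multiset (Sym2 V)}
    (hE : MLGspace k E) (hw : ¬ HasOpenWedge E) {u v w x y : V} (huv : u ≠ v) (huw : u ≠ w)
    (hvw : v ≠ w) (huvE : s(u, v) ∈ E) (huwE : s(u, w) ∈ E) (hxy : x ≠ y) (hxyE : s(x, y) ∈ E)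
    (hux : u ≠ x) (huxE : s(u, x) ∉ E) :
    ∃ E', Relation.ReflTransGen (GogAdj (MLGspace k)) E E' ∧
      nonLoopCount E' < nonLoopCount E := by
  have trans : ∀ a b c, a ≠ b → a ≠ c → b ≠ c → s(a, b) ∈ E → s(a, c) ∈ E → s(b, c) ∈ E := by
    intro a b c h₁ h₂ h₃ h₄ h₅
    by_contra h
    exact hw ⟨a, b, c, h₁, h₂, h₃, h₄, h₅, h⟩
  have hvx : v ≠ x := by rintro rfl; exact huxE huvE
  have hwx : w ≠ x := by rintro rfl; exact huxE huwE
  have hvxE : s(v, x) ∉ E := fun h =>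
    huxE (trans v u x huv.symm hvx hux (Sym2.eq_swap ▸ huvE) h)
  have hwxE : s(w, x) ∉ E := fun h =>
    huxE (trans w u x huw.symm hwx hux (Sym2.eq_swap ▸ huwE) h)
  have huy : u ≠ y := by rintro rfl; exact huxE (Sym2.eq_swap ▸ hxyE)
  have hvy : v ≠ y := by rintro rfl; exact hvxE (Sym2.eq_swap ▸ hxyE)
  have hwy : w ≠ y := by rintro rfl; exact hwxE (Sym2.eq_swap ▸ hxyE)
  have hvyE : s(v, y) ∉ E := fun h =>
    hvxE (trans y v x hvy.symm hxy.symm hvx (Sym2.eq_swap ▸ h) (Sym2.eq_swap ▸ hxyE))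
  obtain ⟨E₁, hs₁, hc₁, hm₁, hux₁, -, hn₁⟩ := exists_gogAdj_swap hE huvE hxyE
    (sym2_mk_ne (by grind))
    (fun _ => huxE) (fun _ => hvyE) (sym2_mk_ne (by grind))
  obtain ⟨E₂, hs₂, hc₂, -⟩ := exists_gogAdj_close_wedge hs₁.2.1 huw hux hwx
    (hm₁ _ huwE (sym2_mk_ne (by grind)) (sym2_mk_ne (by grind))) hux₁
    (hn₁ _ hwxE (sym2_mk_ne (by grind)) (sym2_mk_ne (by grind)))
  refine ⟨E₂, (Relation.ReflTransGen.single hs₁).tail hs₂, ?_⟩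
  simp only [huv, hxy, hux, hvy, if_false] at hc₁
  omega

/-- Without open wedges, non-loop edges can be destroyed if there is a self-loop outside the
component of a vertex with three neighbours. -/
theorem exists_nonLoopCount_lt_of_loop {k : V → ℕ} {E : Multiset (Sym2 V)}
    (hE : MLGspace k E) (hw : ¬ HasOpenWedge E) {u v w z x : V} (huv : u ≠ v) (huw : u ≠ w)
    (huz : u ≠ z) (hvw : v ≠ w) (hvz : v ≠ z) (hwz : w ≠ z) (huvE : s(u, v) ∈ E)
    (huwE : s(u, w) ∈ E) (huzE : s(u, z) ∈ E) (hxxE : s(x, x) ∈ E)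
    (hux : u ≠ x) (huxE : s(u, x) ∉ E) :
    ∃ E', Relation.ReflTransGen (GogAdj (MLGspace k)) E E' ∧
      nonLoopCount E' < nonLoopCount E := by
  have trans : ∀ a b c, a ≠ b → a ≠ c → b ≠ c → s(a, b) ∈ E → s(a, c) ∈ E → s(b, c) ∈ E := by
    intro a b c h₁ h₂ h₃ h₄ h₅
    by_contra h
    exact hw ⟨a, b, c, h₁, h₂, h₃, h₄, h₅, h⟩
  have aux : ∀ a, u ≠ a → s(u, a) ∈ E → a ≠ x ∧ s(a, x) ∉ E := by
    intro a hua huaE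
    have hax : a ≠ x := by rintro rfl; exact huxE huaE
    exact ⟨hax, fun h => huxE (trans a u x hua.symm hax hux (Sym2.eq_swap ▸ huaE) h)⟩
  obtain ⟨hvx, hvxE⟩ := aux v huv huvE
  obtain ⟨hwx, hwxE⟩ := aux w huw huwE
  obtain ⟨hzx, hzxE⟩ := aux z huz huzE
  have hvzE : s(v, z) ∈ E := trans u v z huv huz hvz huvE huzE
  obtain ⟨E₁, hs₁, hc₁, hm₁, hxu₁, hxv₁, hn₁⟩ := exists_gogAdj_swap hE hxxE huvE
    (sym2_mk_ne (by grind))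
    (fun _ h => huxE (Sym2.eq_swap ▸ h)) (fun _ h => hvxE (Sym2.eq_swap ▸ h))
    (sym2_mk_ne (by grind))
  obtain ⟨E₂, hs₂, hc₂, hm₂, hn₂⟩ := exists_gogAdj_close_wedge hs₁.2.1 huw hux hwx
    (hm₁ _ huwE (sym2_mk_ne (by grind)) (sym2_mk_ne (by grind))) (Sym2.eq_swap ▸ hxu₁)
    (hn₁ _ hwxE (sym2_mk_ne (by grind)) (sym2_mk_ne (by grind)))
  obtain ⟨E₃, hs₃, hc₃, -⟩ := exists_gogAdj_close_wedge hs₂.2.1 hvz hvx hzx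
    (hm₂ _ (hm₁ _ hvzE (sym2_mk_ne (by grind)) (sym2_mk_ne (by grind)))
      (sym2_mk_ne (by grind)) (sym2_mk_ne (by grind)))
    (hm₂ _ (Sym2.eq_swap ▸ hxv₁) (sym2_mk_ne (by grind)) (sym2_mk_ne (by grind)))
    (hn₂ _ (hn₁ _ hzxE (sym2_mk_ne (by grind)) (sym2_mk_ne (by grind)))
      (sym2_mk_ne (by grind)) (sym2_mk_ne (by grind)))
  refine ⟨E₃, ((Relation.ReflTransGen.single hs₁).tail hs₂).tail hs₃, ?_⟩
  simp only [huv, hux.symm, hvx.symm, if_true, if_false] at hc₁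
  omega

theorem mDeg_eq_two_mul_count_add_sum [Fintype V] (E : Multiset (Sym2 V)) (u : V) :
    mDeg E u = 2 * E.count s(u, u) + ∑ v ∈ Finset.univ.erase u, E.count s(u, v) := by
  induction E using Multiset.induction with
  | empty => simp [mDeg_zero]
  | cons e E ih =>
    induction e with | _ a b =>
    rw [mDeg_cons, ih]
    simp only [Multiset.count_cons, Finset.sum_add_distrib]
    by_cases ha : a = u
    · subst ha
      by_cases hb : b = a
      · subst hb
        have : ∀ v ∈ Finset.univ.erase b, (if s(b, v) = s(b, b) then 1 else 0) = 0 := by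
          intro v hv
          rw [if_neg]
          grind
        rw [Finset.sum_congr rfl this]
        simp
        omega
      · have : ∀ v ∈ Finset.univ.erase a, (if s(a, v) = s(a, b) then 1 else 0) =
            if v = b then 1 else 0 := by
          intro v hv
          grind
        rw [Finset.sum_congr rfl this]
        simp [hb, Ne.symm hb]
        omega
    · by_cases hb : b = u
      · subst hb
        have : ∀ v ∈ Finset.univ.erase b, (if s(b, v) = s(a, b) then 1 else 0) =
            if v = a then 1 else 0 := by
          intro v hv
          grind
        rw [Finset.sum_congr rfl this]
        simp [ha, Ne.symm ha]
        omega
      · have : ∀ v ∈ Finset.univ.erase u, (if s(u, v) = s(a, b) then 1 else 0) = 0 := by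
          intro v hv
          grind
        rw [Finset.sum_congr rfl this]
        simp [ha, hb, Ne.symm ha]

/-- The vertices joined to `u` by a non-loop edge. -/
def nonLoopNeighbors [Fintype V] (E : Multiset (Sym2 V)) (u : V) : Finset V :=
  (Finset.univ.erase u).filter fun v => s(u, v) ∈ E

theorem mem_nonLoopNeighbors [Fintype V] {E : Multiset (Sym2 V)} {u v : V} :
    v ∈ nonLoopNeighbors E u ↔ u ≠ v ∧ s(u, v) ∈ E := by
  simp [nonLoopNeighbors, eq_comm]

theorem IsMultiloopGraph.mDeg_eq [Fintype V] {E : Multiset (Sym2 V)} (hE : IsMultiloopGraph E)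
    (u : V) : mDeg E u = 2 * E.count s(u, u) + (nonLoopNeighbors E u).card := by
  rw [mDeg_eq_two_mul_count_add_sum, nonLoopNeighbors, Finset.card_filter]
  congr 1
  refine Finset.sum_congr rfl fun v hv => ?_
  have h := hE u v (Finset.ne_of_mem_erase hv).symm
  split_ifs with hm
  · have := Multiset.count_pos.2 hm
    omega
  · exact Multiset.count_eq_zero.2 hm

theorem IsMultiloopGraph.mDeg_filter_not_isDiag [Fintype V] {E : Multiset (Sym2 V)}
    (hE : IsMultiloopGraph E) (u : V) :
    mDeg (E.filter fun e => ¬ e.IsDiag) u = (nonLoopNeighbors E u).card := by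
  have hF : IsMultiloopGraph (E.filter fun e => ¬ e.IsDiag) := fun a b hab =>
    (Multiset.count_le_of_le _ (Multiset.filter_le _ _)).trans (hE a b hab)
  rw [hF.mDeg_eq, Multiset.count_eq_zero.2 (by simp), mul_zero, zero_add]
  congr 1
  ext v
  simp only [mem_nonLoopNeighbors, Multiset.mem_filter, Sym2.mk_isDiag_iff]
  tauto

/-- Unless every vertex has at most one neighbour, non-loop edges can be destroyed. -/
theorem exists_nonLoopCount_lt [Fintype V] {k : V → ℕ} (hk : ∀ u, 1 ≤ k u)
    (h1 : ∃ u, Odd (k u))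
    (h2 : ∃ v, (k v : ℤ) - ((Fintype.card V : ℤ) - 1) < 0 ∨
      Odd ((k v : ℤ) - ((Fintype.card V : ℤ) - 1)))
    {E : Multiset (Sym2 V)} (hE : MLGspace k E) {u : V} (hu : 1 < (nonLoopNeighbors E u).card) :
    ∃ E', Relation.ReflTransGen (GogAdj (MLGspace k)) E E' ∧
      nonLoopCount E' < nonLoopCount E := by
  by_cases hw : HasOpenWedge E
  · obtain ⟨u, v, x, huv, hux, hvx, huvE, huxE, hvxE⟩ := hw
    obtain ⟨E', hs, hc, -⟩ := exists_gogAdj_close_wedge hE huv hux hvx huvE huxE hvxE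
    exact ⟨E', .single hs, by omega⟩
  have trans : ∀ a b c, a ≠ b → a ≠ c → b ≠ c → s(a, b) ∈ E → s(a, c) ∈ E → s(b, c) ∈ E := by
    intro a b c h₁ h₂ h₃ h₄ h₅
    by_contra h
    exact hw ⟨a, b, c, h₁, h₂, h₃, h₄, h₅, h⟩
  have hdeg : ∀ w, k w = 2 * E.count s(w, w) + (nonLoopNeighbors E w).card := fun w =>
    (hE.2 w).symm.trans (hE.1.mDeg_eq w)
  obtain ⟨v, hv, w, hv', hvw⟩ := Finset.one_lt_card.1 hu
  obtain ⟨huv, huvE⟩ := mem_nonLoopNeighbors.1 hv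
  obtain ⟨huw, huwE⟩ := mem_nonLoopNeighbors.1 hv'
  obtain ⟨o, ho⟩ := h1
  have ho' : Odd (nonLoopNeighbors E o).card := by
    rw [hdeg o] at ho
    grind
  by_cases hsep : u ≠ o ∧ s(u, o) ∉ E
  · obtain ⟨p, hp⟩ := Finset.card_pos.1 ho'.pos
    obtain ⟨hop, hopE⟩ := mem_nonLoopNeighbors.1 hp
    exact exists_nonLoopCount_lt_of_disjoint hE hw huv huw hvw huvE huwE hop hopE hsep.1 hsep.2
  have hcard : 1 < (nonLoopNeighbors E o).card := by
    by_cases huo : u = o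
    · exact huo ▸ hu
    have huoE : s(u, o) ∈ E := by
      by_contra h
      exact hsep ⟨huo, h⟩
    have huN : u ∈ nonLoopNeighbors E o :=
      mem_nonLoopNeighbors.2 ⟨Ne.symm huo, Sym2.eq_swap ▸ huoE⟩
    by_cases hvo : v = o
    · subst hvo
      exact Finset.one_lt_card.2 ⟨u, huN, w,
        mem_nonLoopNeighbors.2 ⟨hvw, trans u v w huv huw hvw huvE huwE⟩, huw⟩
    · exact Finset.one_lt_card.2 ⟨u, huN, v, mem_nonLoopNeighbors.2
        ⟨Ne.symm hvo, trans u o v huo huv (Ne.symm hvo) huoE huvE⟩, huv⟩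
  have hcard' : 2 < (nonLoopNeighbors E o).card := by
    obtain ⟨m, hm⟩ := ho'
    omega
  obtain ⟨a, b, c, ha, hb, hc, hab, hac, hbc⟩ := Finset.two_lt_card_iff.1 hcard'
  rw [mem_nonLoopNeighbors] at ha hb hc
  by_cases hall : ∀ x, o ≠ x → s(o, x) ∈ E
  · exfalso
    obtain ⟨t, ht⟩ := h2
    have hN : nonLoopNeighbors E t = Finset.univ.erase t := by
      ext s
      simp only [mem_nonLoopNeighbors, Finset.mem_erase, Finset.mem_univ, and_true]
      refine ⟨fun h => h.1.symm, fun h => ⟨h.symm, ?_⟩⟩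
      by_cases hot : o = t
      · exact hot ▸ hall s (by rintro rfl; exact h hot)
      by_cases hos : o = s
      · subst hos
        exact Sym2.eq_swap ▸ hall t hot
      exact trans o t s hot hos h.symm (hall t hot) (hall s hos)
    have hkt := hdeg t
    rw [hN, Finset.card_erase_of_mem (Finset.mem_univ t), Finset.card_univ] at hkt
    have : 0 < Fintype.card V := Fintype.card_pos_iff.2 ⟨t⟩
    rcases ht with ht | ⟨m, ht⟩ <;> omega
  push Not at hall
  obtain ⟨x, hox, hoxE⟩ := hall
  rcases (nonLoopNeighbors E x).eq_empty_or_nonempty with hx | ⟨y, hy⟩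
  · have hkx := hdeg x
    have := hk x
    rw [hx, Finset.card_empty] at hkx
    have hxx : s(x, x) ∈ E := Multiset.count_pos.1 (by omega)
    exact exists_nonLoopCount_lt_of_loop hE hw ha.1 hb.1 hc.1 hab hac hbc ha.2 hb.2 hc.2 hxx hox
      hoxE
  · obtain ⟨hxy, hxyE⟩ := mem_nonLoopNeighbors.1 hy
    exact exists_nonLoopCount_lt_of_disjoint hE hw ha.1 hb.1 hab ha.2 hb.2 hxy hxyE hox hoxE

theorem MLGspace.of_reflTransGen {k : V → ℕ} {E E' : Multiset (Sym2 V)} (hE : MLGspace k E)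
    (h : Relation.ReflTransGen (GogAdj (MLGspace k)) E E') : MLGspace k E' := by
  cases h with
  | refl => exact hE
  | tail _ h => exact h.2.1

end MaxLoops

/-- if some degree is odd and some `k v - (n-1)` is negative or odd (all
degrees positive), then every multiloop-graph with degree sequence `k` is connected by
double edge swaps within the space to a multiloop-graph having exactly `⌊k u / 2⌋`
self-loops at every vertex, whose non-loop edges form a simple graph with degree sequence
`k u mod 2`. -/
theorem multiloop_reach_max_loops {V : Type*} [Fintype V] [DecidableEq V]
    (k : V → ℕ) (hk : ∀ u, 1 ≤ k u)
    (h1 : ∃ u, Odd (k u))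
    (h2 : ∃ v, (k v : ℤ) - ((Fintype.card V : ℤ) - 1) < 0 ∨
      Odd ((k v : ℤ) - ((Fintype.card V : ℤ) - 1)))
    (E : Multiset (Sym2 V)) (hE : MLGspace k E) :
    ∃ E' : Multiset (Sym2 V),
      Relation.ReflTransGen (GogAdj (MLGspace k)) E E' ∧
      (∀ u : V, E'.count s(u, u) = k u / 2) ∧
      (∀ u v : V, u ≠ v → E'.count s(u, v) ≤ 1) ∧
      (∀ u : V, mDeg (E'.filter fun e => ¬ e.IsDiag) u = k u % 2) := by
  induction hn : nonLoopCount E using Nat.strong_induction_on generalizing E with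
  | _ n ih =>
    subst hn
    by_cases h : ∃ u, 1 < (nonLoopNeighbors E u).card
    · obtain ⟨u, hu⟩ := h
      obtain ⟨E₁, hr, hlt⟩ := exists_nonLoopCount_lt hk h1 h2 hE hu
      obtain ⟨E', hr', h'⟩ := ih _ hlt E₁ (hE.of_reflTransGen hr) rfl
      exact ⟨E', hr.trans hr', h'⟩
    · push Not at h
      have hdeg : ∀ w, k w = 2 * E.count s(w, w) + (nonLoopNeighbors E w).card := fun w =>
        (hE.2 w).symm.trans (hE.1.mDeg_eq w)
      refine ⟨E, .refl, fun u => ?_, hE.1, fun u => ?_⟩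
      · have := hdeg u
        have := h u
        omega
      · rw [hE.1.mDeg_filter_not_isDiag]
        have := hdeg u
        have := h u
        omega
end
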